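/- arXiv:0704.2386 — 2 statements merged into one kernel-verified Lean document; each statement's English description precedes it below -/
import Mathlib

section
/- Let C = (Q, Σ, Γ, δ, ν, q₀, z₀, 1) be an information-lossless bounded pushdown compressor, let l = ⌈log |Q|⌉ and let m be the maximum length of any output of ν on a single input symbol (logarithms in base |Σ|). Then for every k ∈ ℤ⁺ there exists a bounded pushdown gambler G such that for all w ∈ Σ*: d_G(w) ≥ |Σ|^{|w| − |C(w)| − (|w|/k)(l + log m + log k + 1) − (km + l + log m + log k + 1)}. -/
/-! ### Strings, sequences, gales -/

/-- The length-`n` prefix `S[0..n-1]` of an infinite sequence `S`. -/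
def strPrefix {α : Type} (S : ℕ → α) (n : ℕ) : List α := (List.range n).map S

/-- `d` is an `s`-gale over the alphabet `α`:
it is nonnegative and satisfies `d(w) = |Σ|^{-s} * Σ_{a ∈ Σ} d(wa)`. -/
def IsSGale {α : Type} [Fintype α] (s : ℝ) (d : List α → ℝ) : Prop :=
  (∀ w, 0 ≤ d w) ∧
    ∀ w : List α, d w = (Fintype.card α : ℝ) ^ (-s) * ∑ a : α, d (w ++ [a])

/-- `d` succeeds on the sequence `S`, i.e. `limsup_n d(S[0..n-1]) = ∞`. -/
def succeedsOn {α : Type} (d : List α → ℝ) (S : ℕ → α) : Prop :=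
  ∀ C : ℝ, ∃ n : ℕ, C < d (strPrefix S n)

/-! ### Bounded pushdown machinery

Configurations are pairs (state, stack content), the stack written top-first.
`none` as input symbol denotes a `λ`-transition. -/

/-- One `λ`-transition step on a configuration. -/
def lamStep {α Q Γ : Type} (δ : Q → Option α → Γ → Option (Q × List Γ)) :
    Q × List Γ → Option (Q × List Γ)
  | (_, []) => none
  | (q, a :: v) => (δ q none a).map fun p => (p.1, p.2 ++ v)

/-- `n` consecutive `λ`-transition steps (undefined if any step is undefined). -/
def lamIter {α Q Γ : Type} (δ : Q → Option α → Γ → Option (Q × List Γ)) :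
    ℕ → Q × List Γ → Option (Q × List Γ)
  | 0, cfg => some cfg
  | n + 1, cfg => (lamStep δ cfg).bind (lamIter δ n)

/-- Apply `λ`-transitions as long as possible, but at most `n` times. -/
def lamStar {α Q Γ : Type} (δ : Q → Option α → Γ → Option (Q × List Γ)) :
    ℕ → Q × List Γ → Q × List Γ
  | 0, cfg => cfg
  | n + 1, cfg =>
    match lamStep δ cfg with
    | none => cfg
    | some cfg' => lamStar δ n cfg'

/-- Process one input symbol `b`: first execute the (at most `c`) available
`λ`-transitions, then the transition reading `b`. -/
def symStep {α Q Γ : Type} (δ : Q → Option α → Γ → Option (Q × List Γ)) (c : ℕ)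
    (b : α) (cfg : Q × List Γ) : Option (Q × List Γ) :=
  match lamStar δ c cfg with
  | (_, []) => none
  | (q, a :: v) => (δ q (some b) a).map fun p => (p.1, p.2 ++ v)

/-- The extended transition function: the configuration reached from `cfg`
after processing the input string `w`. -/
def runFrom {α Q Γ : Type} (δ : Q → Option α → Γ → Option (Q × List Γ)) (c : ℕ)
    (cfg : Q × List Γ) (w : List α) : Option (Q × List Γ) :=
  w.foldl (fun o b => o.bind (symStep δ c b)) (some cfg)

/-! ### Bounded pushdown gamblers -/

/-- A bounded pushdown gambler (BPDG) over the input alphabet `α`. -/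
structure BPDG (α : Type) [Fintype α] where
  /-- finite set of states -/
  Q : Type
  /-- finite stack alphabet -/
  Γ : Type
  fintypeQ : Fintype Q
  fintypeΓ : Fintype Γ
  /-- partial transition function; `none` as second argument is a `λ`-transition -/
  δ : Q → Option α → Γ → Option (Q × List Γ)
  /-- betting function: a rational-valued probability measure on `α` for each
  (state, top stack symbol) -/
  β : Q → Γ → α → ℚ
  q0 : Q
  z0 : Γ
  /-- bound on the number of `λ`-transitions per input symbol -/
  c : ℕ
  β_nonneg : ∀ q a b, 0 ≤ β q a b
  β_sum : ∀ q a, ∑ b : α, β q a b = 1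
  /-- determinism: a pair (state, top symbol) admits a `λ`-transition or
  input transitions, but not both -/
  det : ∀ q a, δ q none a = none ∨ ∀ b : α, δ q (some b) a = none
  /-- the bottom symbol `z0` is never removed from the bottom of the stack -/
  bottom : ∀ q (b : Option α), δ q b z0 = none ∨
    ∃ q' v, δ q b z0 = some (q', v ++ [z0])
  /-- no sequence of more than `c` consecutive `λ`-transitions is possible -/
  lamBound : ∀ cfg, lamIter δ (c + 1) cfg = none

namespace BPDG

variable {α : Type} [Fintype α]

/-- The configuration `δ(w)` reached after processing `w` from `(q0, z0)`. -/
def run (G : BPDG α) (w : List α) : Option (G.Q × List G.Γ) :=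
  runFrom G.δ G.c (G.q0, [G.z0]) w

/-- The bet placed on symbol `b` in the (possibly undefined) configuration
`ocfg`: the betting function evaluated at the current state and top stack
symbol (with a fair default bet if the configuration is undefined). -/
noncomputable def betAt (G : BPDG α) (ocfg : Option (G.Q × List G.Γ)) (b : α) : ℝ :=
  match ocfg with
  | some (q, a :: _) => (G.β q a b : ℝ)
  | _ => 1 / (Fintype.card α : ℝ)

/-- The capital after betting on `w`, starting from configuration `ocfg`
with capital 1. -/
noncomputable def martFrom (G : BPDG α) : Option (G.Q × List G.Γ) → List α → ℝ
  | _, [] => 1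
  | ocfg, b :: w =>
      (Fintype.card α : ℝ) * G.betAt ocfg b *
        G.martFrom (ocfg.bind (symStep G.δ G.c b)) w

/-- The martingale `d_G` of the gambler `G`:
`d_G(λ) = 1` and `d_G(wb) = |Σ| d_G(w) β(δ(w))(b)`. -/
noncomputable def mart (G : BPDG α) (w : List α) : ℝ :=
  G.martFrom (some (G.q0, [G.z0])) w

/-- The `s`-gale of `G`: `d^s_G(w) = |Σ|^{(s-1)|w|} d_G(w)`. -/
noncomputable def sgale (G : BPDG α) (s : ℝ) (w : List α) : ℝ :=
  (Fintype.card α : ℝ) ^ ((s - 1) * (w.length : ℝ)) * G.mart w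

/-- `G` is nonvanishing if `0 < β(q,z)(b) < 1` for all `q`, `z`, `b`. -/
def nonvanishing (G : BPDG α) : Prop :=
  ∀ q z b, 0 < G.β q z b ∧ G.β q z b < 1

/-- The number of stack symbols of `G`. -/
def numStackSymbols (G : BPDG α) : ℕ := @Fintype.card G.Γ G.fintypeΓ

end BPDG

/-- The bounded pushdown dimension of a sequence `S`: the infimum of all
`s ∈ [0,∞)` such that some bounded pushdown `s`-gale succeeds on `S`. -/
noncomputable def dimBPD {α : Type} [Fintype α] (S : ℕ → α) : ℝ :=
  sInf {s : ℝ | 0 ≤ s ∧ ∃ G : BPDG α, succeedsOn (G.sgale s) S}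

/-! ### Bounded pushdown compressors -/

/-- A bounded pushdown compressor (BPDC) over the input/output alphabet `α`. -/
structure BPDC (α : Type) [Fintype α] where
  /-- finite set of states -/
  Q : Type
  /-- finite stack alphabet -/
  Γ : Type
  fintypeQ : Fintype Q
  fintypeΓ : Fintype Γ
  /-- partial transition function; `none` as second argument is a `λ`-transition -/
  δ : Q → Option α → Γ → Option (Q × List Γ)
  /-- output function -/
  ν : Q → α → Γ → List α
  q0 : Q
  z0 : Γ
  /-- bound on the number of `λ`-transitions per input symbol -/
  c : ℕ
  det : ∀ q a, δ q none a = none ∨ ∀ b : α, δ q (some b) a = none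
  bottom : ∀ q (b : Option α), δ q b z0 = none ∨
    ∃ q' v, δ q b z0 = some (q', v ++ [z0])
  lamBound : ∀ cfg, lamIter δ (c + 1) cfg = none

namespace BPDC

variable {α : Type} [Fintype α]

/-- The configuration reached after processing `w` from `(q0, z0)`. -/
def run (C : BPDC α) (w : List α) : Option (C.Q × List C.Γ) :=
  runFrom C.δ C.c (C.q0, [C.z0]) w

/-- The output produced on reading symbol `b` in configuration `ocfg`. -/
def outAt (C : BPDC α) (ocfg : Option (C.Q × List C.Γ)) (b : α) : List α :=
  match ocfg with
  | some (q, a :: _) => C.ν q b a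
  | _ => []

/-- The output produced on input `w` starting from configuration `ocfg`. -/
def outFrom (C : BPDC α) : Option (C.Q × List C.Γ) → List α → List α
  | _, [] => []
  | ocfg, b :: w =>
      C.outAt ocfg b ++ C.outFrom (ocfg.bind (symStep C.δ C.c b)) w

/-- The output `C(w)` of the compressor on input `w`. -/
def output (C : BPDC α) (w : List α) : List α :=
  C.outFrom (some (C.q0, [C.z0])) w

/-- The output `ν(q, w, z)` produced on input `w` from state `q` with stack
content `z`. -/
def outputFrom (C : BPDC α) (q : C.Q) (z : List C.Γ) (w : List α) : List α :=
  C.outFrom (some (q, z)) w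

/-- `C` is information-lossless: `w ↦ (C(w), final state)` is one-to-one. -/
def IL (C : BPDC α) : Prop :=
  Function.Injective fun w : List α => (C.output w, (C.run w).map Prod.fst)

/-- The compression ratio of `C` on `S`: `liminf_n |C(S[0..n-1])| / n`. -/
noncomputable def compRatio (C : BPDC α) (S : ℕ → α) : ℝ :=
  Filter.liminf (fun n : ℕ => ((C.output (strPrefix S n)).length : ℝ) / n)
    Filter.atTop

/-- The number `|Q|` of states of `C`. -/
def numStates (C : BPDC α) : ℕ := @Fintype.card C.Q C.fintypeQ

/-- The number of stack symbols of `C`. -/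
def numStackSymbols (C : BPDC α) : ℕ := @Fintype.card C.Γ C.fintypeΓ

/-- The maximum length of any output of `ν` on a single input symbol. -/
def maxOut (C : BPDC α) : ℕ :=
  letI := C.fintypeQ
  letI := C.fintypeΓ
  Finset.univ.sup fun p : C.Q × α × C.Γ => (C.ν p.1 p.2.1 p.2.2).length

end BPDC

/-- The bounded pushdown compression ratio of `S`: the infimum of the
compression ratios achieved on `S` by information-lossless BPD compressors. -/
noncomputable def rhoBPD {α : Type} [Fintype α] (S : ℕ → α) : ℝ :=
  sInf {r : ℝ | ∃ C : BPDC α, C.IL ∧ C.compRatio S = r}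

/-! ### Finite-state gamblers -/

/-- A finite-state gambler over the alphabet `α`. -/
structure FSG (α : Type) [Fintype α] where
  /-- finite set of states -/
  Q : Type
  fintypeQ : Fintype Q
  δ : Q → α → Q
  β : Q → α → ℚ
  q0 : Q
  β_nonneg : ∀ q b, 0 ≤ β q b
  β_sum : ∀ q, ∑ b : α, β q b = 1

namespace FSG

variable {α : Type} [Fintype α]

/-- Capital after betting on `w` from state `q` with capital 1. -/
noncomputable def martFrom (G : FSG α) : G.Q → List α → ℝ
  | _, [] => 1
  | q, b :: w => (Fintype.card α : ℝ) * (G.β q b : ℝ) * G.martFrom (G.δ q b) w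

/-- The martingale of the finite-state gambler `G`. -/
noncomputable def mart (G : FSG α) (w : List α) : ℝ := G.martFrom G.q0 w

/-- The `s`-gale of `G`: `d^s_G(w) = |Σ|^{(s-1)|w|} d_G(w)`. -/
noncomputable def sgale (G : FSG α) (s : ℝ) (w : List α) : ℝ :=
  (Fintype.card α : ℝ) ^ ((s - 1) * (w.length : ℝ)) * G.mart w

end FSG

/-- Finite-state dimension of a sequence `S`. -/
noncomputable def dimFS {α : Type} [Fintype α] (S : ℕ → α) : ℝ :=
  sInf {s : ℝ | 0 ≤ s ∧ ∃ G : FSG α, succeedsOn (G.sgale s) S}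

/-! ### The Lempel-Ziv algorithm (over the binary alphabet) -/

/-- Greedy LZ78 parsing: the next phrase is the shortest nonempty prefix of the
remaining input that is not already a phrase in the dictionary (the empty
phrase `x₀ = λ` is implicitly in the dictionary); a final repeated phrase is
allowed. `fuel` is an upper bound on the number of phrases. -/
def lzParseAux : ℕ → List Bool → List (List Bool) → List (List Bool)
  | 0, rest, _ => if rest = [] then [] else [rest]
  | fuel + 1, rest, dict =>
    if rest = [] then []
    else
      match ((List.range rest.length).map fun i => rest.take (i + 1)).find?
          (fun p => !dict.contains p) with
      | none => [rest]
      | some p => p :: lzParseAux fuel (rest.drop p.length) (dict ++ [p])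

/-- The LZ78 parsing of `x` into phrases. -/
def lzParse (x : List Bool) : List (List Bool) := lzParseAux x.length x []

/-- The length of the LZ output on `x`: the `i`-th phrase (1-indexed) is encoded
by a code for the index `l(i) < i` of its longest proper prefix among the earlier
phrases, taking `⌈log₂ i⌉` bits, plus one bit for the new symbol. -/
def lzLen (x : List Bool) : ℕ :=
  ∑ i ∈ Finset.range (lzParse x).length, (Nat.clog 2 (i + 1) + 1)

/-- The LZ compression ratio of a sequence `S`. -/
noncomputable def rhoLZ (S : ℕ → Bool) : ℝ :=
  Filter.liminf (fun n : ℕ => (lzLen (strPrefix S n) : ℝ) / n) Filter.atTop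

/-! ### Proof of the theorem -/

namespace BPDProof

open BPDC

section locality

variable {α Q Γ : Type} (δ : Q → Option α → Γ → Option (Q × List Γ))

lemma symStep_append (b : α) (q : Q) (v r : List Γ) (hv : 2 ≤ v.length) :
    symStep δ 1 b (q, v ++ r) = (symStep δ 1 b (q, v)).map (fun p => (p.1, p.2 ++ r)) := by
  match v, hv with
  | a :: a' :: v', _ =>
    rcases h : δ q none a with _ | ⟨q1, p⟩
    · simp [symStep, lamStar, lamStep, h, Option.map_map, Function.comp_def]
    · rcases p with _ | ⟨x, p⟩ <;>
      simp [symStep, lamStar, lamStep, h, Option.map_map, Function.comp_def]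

lemma symStep_len (P : ℕ) (hP : ∀ q o a p, δ q o a = some p → p.2.length ≤ P)
    (b : α) (q : Q) (v : List Γ) (q' : Q) (v' : List Γ)
    (h : symStep δ 1 b (q, v) = some (q', v')) :
    v.length ≤ v'.length + 2 ∧ v'.length ≤ v.length + 2 * P := by
  have key : ∀ (q1 : Q) (y : List Γ), (match ((q1, y) : Q × List Γ) with
      | (_, []) => none
      | (q, a :: v) => (δ q (some b) a).map fun p => (p.1, p.2 ++ v)) = some (q', v') →
      y.length ≤ v'.length + 1 ∧ v'.length ≤ y.length + P := by
    intro q1 y hy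
    rcases y with _ | ⟨x, y⟩
    · simp at hy
    · simp only [Option.map_eq_some_iff] at hy
      obtain ⟨p, hp, hp2⟩ := hy
      have := hP _ _ _ _ hp
      have e : v' = p.2 ++ y := by
        have := congrArg Prod.snd hp2
        exact this.symm
      subst e
      simp only [List.length_append, List.length_cons]
      omega
  rcases v with _ | ⟨a, v⟩
  · simp [symStep, lamStar, lamStep] at h
  · rcases h1 : δ q none a with _ | ⟨q1, p⟩
    · simp only [symStep, lamStar, lamStep, h1, Option.map_none] at h
      have := key q (a :: v) h
      omega
    · simp only [symStep, lamStar, lamStep, h1, Option.map_some] at h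
      have := key q1 (p ++ v) h
      have := hP _ _ _ _ h1
      simp only [List.length_append, List.length_cons] at *
      omega

end locality

variable {α : Type} [Fintype α]

/-- Total weight of the continuations of length `j`. -/
def W (C : BPDC α) : ℕ → Option (C.Q × List C.Γ) → ℚ
  | 0, _ => 1
  | j + 1, o => ∑ b : α, ((Fintype.card α : ℚ) ^ (C.outAt o b).length)⁻¹ *
      W C j (o.bind (symStep C.δ C.c b))

lemma W_pos [Nonempty α] (C : BPDC α) (j : ℕ) : ∀ o, 0 < W C j o := by
  induction j with
  | zero => intro o; simp [W]
  | succ j ih =>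
    intro o
    have hA : (0 : ℚ) < Fintype.card α := by exact_mod_cast Fintype.card_pos
    exact Finset.sum_pos (fun b _ => mul_pos (inv_pos.2 (pow_pos hA _)) (ih _))
      Finset.univ_nonempty

lemma outAt_le (C : BPDC α) (o) (b : α) : (C.outAt o b).length ≤ C.maxOut := by
  rcases o with _ | ⟨q, _ | ⟨a, v⟩⟩
  · simp [outAt]
  · simp [outAt]
  · let _ := C.fintypeQ
    let _ := C.fintypeΓ
    exact Finset.le_sup (f := fun p : C.Q × α × C.Γ => (C.ν p.1 p.2.1 p.2.2).length)
      (Finset.mem_univ (q, b, a))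

lemma outFrom_le (C : BPDC α) (w : List α) :
    ∀ o, (C.outFrom o w).length ≤ w.length * C.maxOut := by
  induction w with
  | nil => intro o; simp [outFrom]
  | cons b w ih =>
    intro o
    have h1 := outAt_le C o b
    have h2 := ih (o.bind (symStep C.δ C.c b))
    simp only [outFrom, List.length_append, List.length_cons]
    nlinarith

lemma W_ge [Nonempty α] (C : BPDC α) (j : ℕ) :
    ∀ o, ((Fintype.card α : ℚ) ^ (j * C.maxOut))⁻¹ ≤ W C j o := by
  induction j with
  | zero => intro o; simp [W]
  | succ j ih =>
    intro o
    have hA : (1 : ℚ) ≤ Fintype.card α := by exact_mod_cast Fintype.card_pos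
    have hA0 : (0 : ℚ) < Fintype.card α := by linarith
    have h1 : ∀ b : α, ((Fintype.card α : ℚ) ^ ((j + 1) * C.maxOut))⁻¹ ≤
        ((Fintype.card α : ℚ) ^ (C.outAt o b).length)⁻¹ *
          W C j (o.bind (symStep C.δ C.c b)) := by
      intro b
      rw [add_mul, one_mul, pow_add, mul_inv, mul_comm]
      refine mul_le_mul ?_ (ih _) (by positivity) (by positivity)
      exact inv_anti₀ (by positivity) (pow_le_pow_right₀ hA (outAt_le C o b))
    obtain ⟨b⟩ := (inferInstance : Nonempty α)
    refine (h1 b).trans ?_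
    exact Finset.single_le_sum (f := fun b => ((Fintype.card α : ℚ) ^ (C.outAt o b).length)⁻¹ *
          W C j (o.bind (symStep C.δ C.c b)))
      (fun b _ => le_trans (by positivity) (h1 b)) (Finset.mem_univ b)

lemma outAt_append (C : BPDC α) (q : C.Q) (v r : List C.Γ) (hv : 2 ≤ v.length) (b : α) :
    C.outAt (some (q, v ++ r)) b = C.outAt (some (q, v)) b := by
  match v, hv with
  | a :: v', _ => simp [outAt]

lemma W_append (C : BPDC α) (hc : C.c = 1) (j : ℕ) :
    ∀ (q : C.Q) (v r : List C.Γ), 2 * j ≤ v.length →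
      W C j (some (q, v ++ r)) = W C j (some (q, v)) := by
  induction j with
  | zero => intros; simp [W]
  | succ j ih =>
    intro q v r hv
    simp only [W]
    refine Finset.sum_congr rfl fun b _ => ?_
    rw [outAt_append C q v r (by omega)]
    congr 1
    simp only [Option.bind_some, hc]
    rw [symStep_append _ _ _ _ _ (by omega)]
    rcases h : symStep C.δ 1 b (q, v) with _ | ⟨q', v'⟩
    · simp
    · let _ := C.fintypeQ
      let _ := C.fintypeΓ
      simp only [Option.map_some]
      apply ih
      have hl : v.length ≤ v'.length + 2 := by
        classical
        let S : Finset ℕ := Finset.univ.image fun p : C.Q × Option α × C.Γ =>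
          ((C.δ p.1 p.2.1 p.2.2).map (fun y => y.2.length)).getD 0
        refine (symStep_len C.δ (S.sup id) ?_ b q v q' v' h).1
        intro q o a p hp
        have : p.2.length ∈ S := Finset.mem_image.2 ⟨(q, o, a), Finset.mem_univ _, by simp [hp]⟩
        exact Finset.le_sup (f := id) this
      omega

lemma exists_P (C : BPDC α) : ∃ P, ∀ q o a p, C.δ q o a = some p → p.2.length ≤ P := by
  classical
  let _ := C.fintypeQ
  let _ := C.fintypeΓ
  let S : Finset ℕ := Finset.univ.image fun p : C.Q × Option α × C.Γ =>
    ((C.δ p.1 p.2.1 p.2.2).map (fun y => y.2.length)).getD 0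
  refine ⟨S.sup id, ?_⟩
  intro q o a p hp
  have : p.2.length ∈ S := Finset.mem_image.2 ⟨(q, o, a), Finset.mem_univ _, by simp [hp]⟩
  exact Finset.le_sup (f := id) this

/-! #### Counting -/

/-- Run from an optional configuration. -/
def orun (C : BPDC α) (o : Option (C.Q × List C.Γ)) (w : List α) : Option (C.Q × List C.Γ) :=
  w.foldl (fun o b => o.bind (symStep C.δ C.c b)) o

lemma W_eq_sum (C : BPDC α) (j : ℕ) : ∀ o, W C j o =
    ∑ u : Fin j → α, ((Fintype.card α : ℚ) ^ (C.outFrom o (List.ofFn u)).length)⁻¹ := by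
  induction j with
  | zero => intro o; simp [W, outFrom]
  | succ j ih =>
    intro o
    rw [← (Fin.consEquiv (fun _ : Fin (j + 1) => α)).sum_comp, Fintype.sum_prod_type]
    simp only [W]
    refine Finset.sum_congr rfl fun b _ => ?_
    rw [ih, Finset.mul_sum]
    refine Finset.sum_congr rfl fun u _ => ?_
    simp [Fin.consEquiv, List.ofFn_succ, outFrom, pow_add, mul_comm]

lemma outFrom_append (C : BPDC α) (u w : List α) : ∀ o,
    C.outFrom o (u ++ w) = C.outFrom o u ++ C.outFrom (orun C o u) w := by
  induction u with
  | nil => intro o; simp [outFrom, orun]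
  | cons b u ih => intro o; simp [outFrom, orun, ih]

lemma orun_append (C : BPDC α) (u w : List α) (o) :
    orun C o (u ++ w) = orun C (orun C o u) w := by
  simp [orun, List.foldl_append]

lemma run_eq (C : BPDC α) (w : List α) : C.run w = orun C (some (C.q0, [C.z0])) w := rfl

lemma run_isSome [Nonempty α] (C : BPDC α) (hIL : C.IL) (w : List α) : ∃ p, C.run w = some p := by
  rcases h : C.run w with _ | p
  · exfalso
    obtain ⟨b⟩ := (inferInstance : Nonempty α)
    have h2 : C.run (w ++ [b]) = none := by
      rw [run_eq, orun_append, ← run_eq, h]; rfl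
    have h3 : C.output (w ++ [b]) = C.output w := by
      unfold output
      rw [outFrom_append, ← run_eq, h]; simp [outFrom, outAt]
    have := @hIL (w ++ [b]) w (by simp [h, h2, h3])
    simp at this
  · exact ⟨p, rfl⟩

lemma W_le [Nonempty α] (C : BPDC α) (hIL : C.IL) (w : List α) (k : ℕ) :
    W C k (C.run w) ≤ C.numStates * (k * C.maxOut + 1 : ℕ) := by
  classical
  let _ := C.fintypeQ
  have hA : (0 : ℚ) < Fintype.card α := by exact_mod_cast Fintype.card_pos
  rw [W_eq_sum]
  choose st hst using run_isSome C hIL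
  have hlen : ∀ u : Fin k → α,
      (C.outFrom (C.run w) (List.ofFn u)).length < k * C.maxOut + 1 := by
    intro u
    have := outFrom_le C (List.ofFn u) (C.run w)
    simp only [List.length_ofFn] at this
    omega
  let f : (Fin k → α) → ((j : Fin (k * C.maxOut + 1)) × List.Vector α j) × C.Q := fun u =>
    (⟨⟨_, hlen u⟩, ⟨C.outFrom (C.run w) (List.ofFn u), rfl⟩⟩, (st (w ++ List.ofFn u)).1)
  let g : ((j : Fin (k * C.maxOut + 1)) × List.Vector α j) × C.Q → ℚ := fun x =>
    ((Fintype.card α : ℚ) ^ (x.1.1 : ℕ))⁻¹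
  have hf : Function.Injective f := by
    intro u u' h
    have h2 : (st (w ++ List.ofFn u)).1 = (st (w ++ List.ofFn u')).1 := congrArg Prod.snd h
    have h1 : C.outFrom (C.run w) (List.ofFn u) = C.outFrom (C.run w) (List.ofFn u') :=
      congrArg (fun x : ((j : Fin (k * C.maxOut + 1)) × List.Vector α j) × C.Q => x.1.2.1) h
    have := @hIL (w ++ List.ofFn u) (w ++ List.ofFn u') (by
      simp only [hst, Option.map_some, h2, output, outFrom_append]
      rw [← run_eq, h1])
    exact List.ofFn_injective (List.append_cancel_left this)
  calc ∑ u : Fin k → α, ((Fintype.card α : ℚ) ^ (C.outFrom (C.run w) (List.ofFn u)).length)⁻¹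
      = ∑ u : Fin k → α, g (f u) := rfl
    _ = ∑ x ∈ Finset.univ.map ⟨f, hf⟩, g x := by simp
    _ ≤ ∑ x, g x := Finset.sum_le_sum_of_subset_of_nonneg (Finset.subset_univ _)
        (fun x _ _ => by positivity)
    _ = C.numStates * (k * C.maxOut + 1 : ℕ) := by
        rw [Fintype.sum_prod_type_right]
        have : ∀ j : Fin (k * C.maxOut + 1),
            ∑ _v : List.Vector α j, ((Fintype.card α : ℚ) ^ (j : ℕ))⁻¹ = 1 := by
          intro j
          rw [Finset.sum_const, Finset.card_univ, card_vector, nsmul_eq_mul]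
          push_cast
          exact mul_inv_cancel₀ (by positivity)
        simp only [Fintype.sum_sigma, g, this]
        simp [numStates, mul_add]

lemma maxOut_pos [Nonempty α] (C : BPDC α) (hIL : C.IL) : 0 < C.maxOut := by
  by_contra h
  have h0 : C.maxOut = 0 := by omega
  have hout : ∀ w, C.output w = [] := by
    intro w
    have := outFrom_le C w (some (C.q0, [C.z0]))
    rw [h0] at this
    exact List.length_eq_zero_iff.1 (by simpa [output] using this)
  let _ := C.fintypeQ
  have : Function.Injective fun w : List α => (C.run w).map Prod.fst := by
    intro w w' hw
    exact hIL (by simp only [hout]; simpa using hw)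
  exact not_injective_infinite_finite _ this


/-! #### The gambler -/

/-- Bounded lists. -/
abbrev Buf (Γ : Type) (L : ℕ) : Type := {l : List Γ // l.length ≤ L}

/-- Truncation to a bounded list. -/
def mkB {Γ : Type} (L : ℕ) (l : List Γ) : Buf Γ L := ⟨l.take L, by simp⟩

lemma mkB_val {Γ : Type} (L : ℕ) (l : List Γ) (h : l.length ≤ L) : (mkB L l).1 = l := by
  simp [mkB, h]

lemma finite_Buf {Γ : Type} [Finite Γ] (L : ℕ) : Finite (Buf Γ L) :=
  (List.finite_length_le Γ L).to_subtype

/-- Refill the buffer from the top chunk. -/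
def merge {Γ : Type} (k : ℕ) {L : ℕ} (v : List Γ) (t : Option (Buf Γ L)) :
    List Γ × List (Option (Buf Γ L)) :=
  if v.length < 2 * k then
    match t with
    | none => (v, [none])
    | some c => (v ++ c.1, [])
  else (v, [t])

/-- Push the excess of the buffer as a chunk. -/
def split {Γ : Type} (k : ℕ) {L : ℕ} (x : List Γ × List (Option (Buf Γ L))) :
    List Γ × List (Option (Buf Γ L)) :=
  if 4 * k ≤ x.1.length then (x.1.take (2 * k), some (mkB L (x.1.drop (2 * k))) :: x.2) else x

/-- Block phase: the number of remaining symbols after the next one. -/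
def nxt {k : ℕ} (i : Fin k) : Fin k :=
  if i.1 = 0 then ⟨k - 1, by have := i.2; omega⟩ else ⟨i.1 - 1, by have := i.2; omega⟩

/-- Transition function of the gambler. -/
def gδ (C : BPDC α) (k L : ℕ) (s : C.Q × Buf C.Γ L × Fin k) (o : Option α)
    (t : Option (Buf C.Γ L)) :
    Option ((C.Q × Buf C.Γ L × Fin k) × List (Option (Buf C.Γ L))) :=
  match o with
  | none => none
  | some b => (symStep C.δ C.c b (s.1, s.2.1.1)).map fun p =>
      ((p.1, mkB L (split k (merge k p.2 t)).1, nxt s.2.2), (split k (merge k p.2 t)).2)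

/-- Betting function of the gambler. -/
def gβ (C : BPDC α) (k L : ℕ) (s : C.Q × Buf C.Γ L × Fin k) (b : α) : ℚ :=
  ((Fintype.card α : ℚ) ^ (C.outAt (some (s.1, s.2.1.1)) b).length)⁻¹ *
    W C s.2.2.1 ((some (s.1, s.2.1.1)).bind (symStep C.δ C.c b)) /
    W C (s.2.2.1 + 1) (some (s.1, s.2.1.1))

/-- The gambler. -/
noncomputable def gam [Nonempty α] (C : BPDC α) (k : ℕ) (hk : 0 < k) (L : ℕ) : BPDG α where
  Q := C.Q × Buf C.Γ L × Fin k
  Γ := Option (Buf C.Γ L)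
  fintypeQ :=
    letI := C.fintypeQ
    letI := C.fintypeΓ
    letI : Fintype (Buf C.Γ L) := @Fintype.ofFinite _ (finite_Buf L)
    inferInstance
  fintypeΓ :=
    letI := C.fintypeΓ
    letI : Fintype (Buf C.Γ L) := @Fintype.ofFinite _ (finite_Buf L)
    inferInstance
  δ := gδ C k L
  β := fun s _ b => gβ C k L s b
  q0 := (C.q0, mkB L [C.z0], ⟨k - 1, by omega⟩)
  z0 := none
  c := 0
  β_nonneg := fun s _ b => by
    have := (W_pos C s.2.2.1 ((some (s.1, s.2.1.1)).bind (symStep C.δ C.c b))).le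
    have := (W_pos C (s.2.2.1 + 1) (some (s.1, s.2.1.1))).le
    unfold gβ
    positivity
  β_sum := fun s _ => by
    have h := (W_pos C (s.2.2.1 + 1) (some (s.1, s.2.1.1))).ne'
    simp only [gβ]
    rw [← Finset.sum_div]
    exact div_self h
  det := fun _ _ => Or.inl rfl
  bottom := fun s o => by
    rcases o with _ | b
    · exact Or.inl rfl
    · rcases h : symStep C.δ C.c b (s.1, s.2.1.1) with _ | p
      · left; simp [gδ, h]
      · right
        simp only [gδ, h, Option.map_some]
        have hm : (merge k (L := L) p.2 none).2 = [none] := by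
          unfold merge; split_ifs <;> rfl
        refine ⟨(p.1, mkB L (split k (merge k (L := L) p.2 none)).1, nxt s.2.2), ?_⟩
        by_cases h4 : 4 * k ≤ (merge k (L := L) p.2 none).1.length
        · exact ⟨[some (mkB L ((merge k (L := L) p.2 none).1.drop (2 * k)))], by
            simp [split, h4, hm]⟩
        · exact ⟨[], by simp [split, h4, hm]⟩
  lamBound := fun cfg => by
    rcases cfg with ⟨s, _ | ⟨a, v⟩⟩ <;> simp [lamIter, lamStep, gδ]

/-- The gambler configuration represents the compressor configuration. -/
def Rep (C : BPDC α) (k P L : ℕ) (q : C.Q) (z : List C.Γ) (s : C.Q × Buf C.Γ L × Fin k)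
    (y : List (Option (Buf C.Γ L))) : Prop :=
  s.1 = q ∧ ∃ cs : List (Buf C.Γ L), y = cs.map some ++ [none] ∧
    z = s.2.1.1 ++ (cs.map Subtype.val).flatten ∧
    (∀ c ∈ cs, 2 * k ≤ c.1.length ∧ c.1.length ≤ 2 * k + 2 * P) ∧
    s.2.1.1.length < 4 * k ∧ (2 * k ≤ s.2.1.1.length ∨ cs = [])

lemma Rep_split (C : BPDC α) (k P L : ℕ) (hL : 4 * k + 2 * P ≤ L) (q : C.Q) (i : Fin k)
    (x : List C.Γ) (cs : List (Buf C.Γ L))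
    (hx : x.length ≤ 4 * k + 2 * P)
    (hcs : ∀ c ∈ cs, 2 * k ≤ c.1.length ∧ c.1.length ≤ 2 * k + 2 * P)
    (h2 : 2 * k ≤ x.length ∨ cs = []) (y y' : List (Option (Buf C.Γ L)))
    (hy : y ++ y' = cs.map some ++ [none]) :
    Rep C k P L q (x ++ (cs.map Subtype.val).flatten)
      (q, mkB L (split k (x, y)).1, i) ((split k (x, y)).2 ++ y') := by
  refine ⟨rfl, ?_⟩
  by_cases h4 : 4 * k ≤ x.length
  · simp only [split, h4, if_true]
    have hd : (mkB L (x.drop (2 * k))).1 = x.drop (2 * k) := mkB_val _ _ (by simp; omega)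
    have ht : (mkB L (x.take (2 * k))).1 = x.take (2 * k) := mkB_val _ _ (by simp; omega)
    refine ⟨mkB L (x.drop (2 * k)) :: cs, ?_, ?_, ?_, ?_, ?_⟩
    · simp [hy]
    · simp only [List.map_cons, List.flatten_cons, hd, ht]
      rw [← List.append_assoc, List.take_append_drop]
    · intro c hc
      rcases List.mem_cons.1 hc with rfl | hc
      · rw [hd]; simp only [List.length_drop]; omega
      · exact hcs c hc
    · have := i.2
      rw [ht]; simp only [List.length_take]; omega
    · left; rw [ht]; simp only [List.length_take]; omega
  · simp only [split, h4, if_false]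
    have ht : (mkB L x).1 = x := mkB_val _ _ (by omega)
    refine ⟨cs, hy, by rw [ht], hcs, by rw [ht]; omega, by rw [ht]; exact h2⟩

lemma Rep_step [Nonempty α] (C : BPDC α) (hc : C.c = 1) (k : ℕ) (hk : 0 < k) (P L : ℕ)
    (hP : ∀ q o a p, C.δ q o a = some p → p.2.length ≤ P)
    (hL : 4 * k + 2 * P ≤ L) (b : α) (q : C.Q) (z : List C.Γ)
    (s : C.Q × Buf C.Γ L × Fin k) (y : List (Option (Buf C.Γ L)))
    (hR : Rep C k P L q z s y) (q' : C.Q) (z' : List C.Γ)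
    (hs : symStep C.δ C.c b (q, z) = some (q', z')) :
    ∃ s' y', symStep (gδ C k L) 0 b (s, y) = some (s', y') ∧ s'.2.2 = nxt s.2.2 ∧
      Rep C k P L q' z' s' y' := by
  obtain ⟨q1, v, i⟩ := s
  obtain ⟨rfl, cs, rfl, rfl, hcs, hv4, hv2⟩ := hR
  simp only at *
  have : ∃ v', symStep C.δ C.c b (q1, v.1) = some (q', v') ∧
      z' = v' ++ (cs.map Subtype.val).flatten := by
    rcases hv2 with hv2 | rfl
    · rw [hc] at hs ⊢
      rw [symStep_append _ _ _ _ _ (by omega)] at hs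
      simp only [Option.map_eq_some_iff, Prod.mk.injEq] at hs
      obtain ⟨p, hp, rfl, rfl⟩ := hs
      exact ⟨p.2, hp, rfl⟩
    · exact ⟨z', by simpa using hs, by simp⟩
  obtain ⟨v', hv', rfl⟩ := this
  have hlen := symStep_len C.δ P hP b q1 v.1 q' v' (by rw [← hc]; exact hv')
  rcases cs with _ | ⟨c, cs⟩
  · refine ⟨(q', mkB L (split k (merge k v' (none : Option (Buf C.Γ L)))).1, nxt i),
      (split k (merge k v' (none : Option (Buf C.Γ L)))).2 ++ [], ?_, rfl, ?_⟩
    · change Option.map _ (gδ C k L (q1, v, i) (some b) _) = _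
      simp [gδ, hv']
    · have hm : merge k v' (none : Option (Buf C.Γ L)) = (v', [none]) := by
        unfold merge; split_ifs <;> rfl
      rw [hm]
      exact Rep_split C k P L hL q' (nxt i) v' [] (by omega) (by simp) (Or.inr rfl) _ _ (by simp)
  · have hc1 := hcs c (by simp)
    have hcs' : ∀ c ∈ cs, 2 * k ≤ c.1.length ∧ c.1.length ≤ 2 * k + 2 * P :=
      fun c h => hcs c (by simp [h])
    refine ⟨(q', mkB L (split k (merge k v' (some c))).1, nxt i),
      (split k (merge k v' (some c))).2 ++ (cs.map some ++ [none]), ?_, rfl, ?_⟩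
    · change Option.map _ (gδ C k L (q1, v, i) (some b) _) = _
      simp [gδ, hv']
    · by_cases h : v'.length < 2 * k
      · have hm : merge k v' (some c) = (v' ++ c.1, []) := by simp [merge, h]
        rw [hm]
        have := Rep_split C k P L hL q' (nxt i) (v' ++ c.1) cs
          (by simp only [List.length_append]; omega) hcs'
          (Or.inl (by simp only [List.length_append]; omega)) [] (cs.map some ++ [none]) (by simp)
        simpa using this
      · have hm : merge k v' (some c) = (v', [some c]) := by simp [merge, h]
        rw [hm]
        exact Rep_split C k P L hL q' (nxt i) v' (c :: cs) (by omega) hcs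
          (Or.inl (by omega)) _ _ (by simp)

lemma bet_eq [Nonempty α] (C : BPDC α) (hc : C.c = 1) (k P L : ℕ)
    (b : α) (q : C.Q) (z : List C.Γ)
    (s : C.Q × Buf C.Γ L × Fin k) (y : List (Option (Buf C.Γ L)))
    (hR : Rep C k P L q z s y) :
    gβ C k L s b = ((Fintype.card α : ℚ) ^ (C.outAt (some (q, z)) b).length)⁻¹ *
      W C s.2.2.1 ((some (q, z)).bind (symStep C.δ C.c b)) /
      W C (s.2.2.1 + 1) (some (q, z)) := by
  obtain ⟨q1, v, i⟩ := s
  obtain ⟨rfl, cs, rfl, rfl, hcs, hv4, hv2⟩ := hR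
  have hi := i.2
  simp only at *
  rcases hv2 with hv2 | rfl
  · unfold gβ
    simp only
    rw [outAt_append C _ _ _ (by omega), W_append C hc _ _ _ _ (by omega)]
    congr 2
    simp only [Option.bind_some]
    rw [hc, symStep_append _ _ _ _ _ (by omega)]
    rcases h : symStep C.δ 1 b (q1, v.1) with _ | ⟨q', v'⟩
    · simp
    · simp only [Option.map_some]
      obtain ⟨P, hP⟩ := exists_P C
      have := symStep_len C.δ P hP b q1 v.1 q' v' h
      exact (W_append C hc _ _ _ _ (by omega)).symm
  · simp [gβ]

lemma main_bound [Nonempty α] (C : BPDC α) (hc : C.c = 1) (hIL : C.IL) (k : ℕ) (hk : 0 < k)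
    (P L : ℕ) (hP : ∀ q o a p, C.δ q o a = some p → p.2.length ≤ P)
    (hL : 4 * k + 2 * P ≤ L) (M : ℝ) (hM0 : 0 ≤ M)
    (hM : ∀ w, ((W C k (C.run w) : ℚ) : ℝ) ≤ (Fintype.card α : ℝ) ^ M) (w : List α) :
    ∀ (w0 : List α) (q : C.Q) (z : List C.Γ) (s : C.Q × Buf C.Γ L × Fin k)
      (y : List (Option (Buf C.Γ L))), C.run w0 = some (q, z) → Rep C k P L q z s y →
    (Fintype.card α : ℝ) ^ ((w.length : ℝ) - ((C.outFrom (some (q, z)) w).length : ℝ) -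
        M * ((w.length + ((k : ℝ) - 1 - (s.2.2.1 : ℝ))) / k) - k * C.maxOut) ≤
      (gam C k hk L).martFrom (some (s, y)) w * (W C (s.2.2.1 + 1) (some (q, z)) : ℚ) := by
  have hA1 : (1 : ℝ) ≤ Fintype.card α := by exact_mod_cast Fintype.card_pos
  have hA : (0 : ℝ) < Fintype.card α := by linarith
  have hkR : (0 : ℝ) < k := by exact_mod_cast hk
  induction w with
  | nil =>
    intro w0 q z s y _ _
    have hi : (s.2.2.1 : ℝ) + 1 ≤ k := by exact_mod_cast s.2.2.2
    have h1 : (((Fintype.card α : ℝ) ^ ((s.2.2.1 + 1) * C.maxOut))⁻¹ : ℝ) ≤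
        ((W C (s.2.2.1 + 1) (some (q, z)) : ℚ) : ℝ) := by
      have h0 := (Rat.cast_le (K := ℝ)).2 (W_ge C (s.2.2.1 + 1) (some (q, z)))
      push_cast at h0
      exact h0
    simp only [BPDG.martFrom, one_mul]
    refine le_trans ?_ h1
    rw [← Real.rpow_natCast, ← Real.rpow_neg hA.le]
    apply Real.rpow_le_rpow_of_exponent_le hA1
    have h2 : 0 ≤ M * ((((([] : List α).length : ℕ) : ℝ) + ((k : ℝ) - 1 - (s.2.2.1 : ℝ))) / k) := by
      apply mul_nonneg hM0
      apply div_nonneg _ hkR.le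
      simp; linarith
    have h3 : ((s.2.2.1 : ℝ) + 1) * C.maxOut ≤ k * C.maxOut := by gcongr
    push_cast
    simp only [outFrom, List.length_nil, Nat.cast_zero] at *
    linarith
  | cons b w ih =>
    intro w0 q z s y hw0 hR
    have hrun : C.run (w0 ++ [b]) = symStep C.δ C.c b (q, z) := by
      rw [run_eq, orun_append, ← run_eq, hw0]; rfl
    obtain ⟨⟨q', z'⟩, hp⟩ := run_isSome C hIL (w0 ++ [b])
    rw [hp] at hrun
    obtain ⟨s', y', hs', hn, hR'⟩ :=
      Rep_step C hc k hk P L hP hL b q z s y hR q' z' hrun.symm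
    have IH := ih (w0 ++ [b]) q' z' s' y' hp hR'
    have hbet : (gam C k hk L).betAt (some (s, y)) b = ((gβ C k L s b : ℚ) : ℝ) := by
      obtain ⟨_, cs, rfl, _⟩ := hR
      cases cs <;> rfl
    have hstep : (some (s, y)).bind (symStep (gam C k hk L).δ (gam C k hk L).c b)
        = some (s', y') := hs'
    have hWp : (0 : ℝ) < ((W C (s.2.2.1 + 1) (some (q, z)) : ℚ) : ℝ) := by
      exact_mod_cast W_pos C _ _
    have hmul : ((gβ C k L s b : ℚ) : ℝ) * ((W C (s.2.2.1 + 1) (some (q, z)) : ℚ) : ℝ) =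
        ((Fintype.card α : ℝ) ^ (C.outAt (some (q, z)) b).length)⁻¹ *
          ((W C s.2.2.1 (some (q', z')) : ℚ) : ℝ) := by
      rw [bet_eq C hc k P L b q z s y hR]
      simp only [Option.bind_some, ← hrun]
      push_cast
      rw [div_mul_cancel₀ _ hWp.ne']
    have e1 : (gam C k hk L).martFrom (some (s, y)) (b :: w) *
        ((W C (s.2.2.1 + 1) (some (q, z)) : ℚ) : ℝ) =
        (Fintype.card α : ℝ) ^ (1 - ((C.outAt (some (q, z)) b).length : ℝ)) *
          ((gam C k hk L).martFrom (some (s', y')) w *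
            ((W C s.2.2.1 (some (q', z')) : ℚ) : ℝ)) := by
      have hmart : (gam C k hk L).martFrom (some (s, y)) (b :: w) =
          (Fintype.card α : ℝ) * ((gβ C k L s b : ℚ) : ℝ) *
            (gam C k hk L).martFrom (some (s', y')) w :=
        congrArg₂ (fun x o => (Fintype.card α : ℝ) * x * (gam C k hk L).martFrom o w) hbet hstep
      rw [hmart, Real.rpow_sub hA, Real.rpow_one, Real.rpow_natCast, div_eq_mul_inv]
      linear_combination (Fintype.card α : ℝ) *
        (gam C k hk L).martFrom (some (s', y')) w * hmul
    rw [e1]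
    have e2 : C.outFrom (some (q, z)) (b :: w) =
        C.outAt (some (q, z)) b ++ C.outFrom (some (q', z')) w := by
      simp only [outFrom, Option.bind_some, ← hrun]
    rw [e2]
    set X := (gam C k hk L).martFrom (some (s', y')) w with hX
    by_cases hi : s.2.2.1 = 0
    · have hn' : s'.2.2.1 = k - 1 := by rw [hn]; simp [nxt, hi]
      have hn2 : s'.2.2.1 + 1 = k := by omega
      have hn3 : (s'.2.2.1 : ℝ) = k - 1 := by
        rw [hn', Nat.cast_sub hk]; simp
      rw [hn2, hn3] at IH
      have hW := hM (w0 ++ [b])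
      rw [hp] at hW
      have hWk : (0 : ℝ) < ((W C k (some (q', z')) : ℚ) : ℝ) := by
        exact_mod_cast W_pos C _ _
      have hX0 : 0 ≤ X := by
        by_contra hneg
        have := mul_neg_of_neg_of_pos (not_le.1 hneg) hWk
        have h0 := Real.rpow_pos_of_pos hA ((w.length : ℝ) -
          ((C.outFrom (some (q', z')) w).length : ℝ) -
          M * ((w.length + ((k : ℝ) - 1 - ((k : ℝ) - 1))) / k) - k * C.maxOut)
        linarith
      have h5 := IH.trans (mul_le_mul_of_nonneg_left hW hX0)
      have h6 : (Fintype.card α : ℝ) ^ ((w.length : ℝ) -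
          ((C.outFrom (some (q', z')) w).length : ℝ) -
          M * ((w.length + ((k : ℝ) - 1 - ((k : ℝ) - 1))) / k) - k * C.maxOut - M) ≤ X := by
        rw [Real.rpow_sub hA, div_le_iff₀ (Real.rpow_pos_of_pos hA _)]
        exact h5
      rw [hi]
      simp only [W, Rat.cast_one, mul_one]
      refine le_trans (le_of_eq ?_) (mul_le_mul_of_nonneg_left h6 (Real.rpow_nonneg hA.le _))
      rw [← Real.rpow_add hA]
      congr 1
      simp only [List.length_append, List.length_cons]
      push_cast
      field_simp
      ring
    · have hn' : s'.2.2.1 + 1 = s.2.2.1 := by rw [hn]; simp [nxt, hi]; omega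
      have hn3 : (s'.2.2.1 : ℝ) = s.2.2.1 - 1 := by rw [← hn']; push_cast; ring
      rw [hn', hn3] at IH
      refine le_trans (le_of_eq ?_) (mul_le_mul_of_nonneg_left IH (Real.rpow_nonneg hA.le _))
      rw [← Real.rpow_add hA]
      congr 1
      simp only [List.length_append, List.length_cons]
      push_cast
      field_simp
      ring

end BPDProof

/-- Let `C` be an information-lossless bounded pushdown
compressor with at most one `λ`-transition per input symbol, `l = ⌈log |Q|⌉`
and `m` the maximum output length of `ν` on a single input symbol (logs in
base `|Σ|`). Then for every `k ∈ ℤ⁺` there is a bounded pushdown gambler `G`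
with `d_G(w) ≥ |Σ|^{|w| - |C(w)| - (|w|/k)(l + log m + log k + 1) - (km + l + log m + log k + 1)}`
for all `w ∈ Σ*`. -/
theorem bpdg_from_bpdc {α : Type} [Fintype α] (hα : 2 ≤ Fintype.card α)
    (C : BPDC α) (hc : C.c = 1) (hIL : C.IL) (k : ℕ) (hk : 0 < k) :
    ∃ G : BPDG α, ∀ w : List α,
      (Fintype.card α : ℝ) ^
          ((w.length : ℝ) - ((C.output w).length : ℝ) -
            ((w.length : ℝ) / (k : ℝ)) *
              ((⌈Real.logb (Fintype.card α) (C.numStates : ℝ)⌉ : ℝ) +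
                Real.logb (Fintype.card α) (C.maxOut : ℝ) +
                Real.logb (Fintype.card α) (k : ℝ) + 1) -
            ((k : ℝ) * (C.maxOut : ℝ) +
              (⌈Real.logb (Fintype.card α) (C.numStates : ℝ)⌉ : ℝ) +
              Real.logb (Fintype.card α) (C.maxOut : ℝ) +
              Real.logb (Fintype.card α) (k : ℝ) + 1)) ≤
        G.mart w := by
  classical
  have hne : Nonempty α := Fintype.card_pos_iff.1 (by omega)
  obtain ⟨P, hP⟩ := BPDProof.exists_P C
  have hm := BPDProof.maxOut_pos C hIL
  have hQ : 0 < C.numStates := by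
    let _ := C.fintypeQ
    exact Fintype.card_pos_iff.2 ⟨C.q0⟩
  have hA2 : (2 : ℝ) ≤ Fintype.card α := by exact_mod_cast hα
  have hA1 : (1 : ℝ) < Fintype.card α := by linarith
  have hA : (0 : ℝ) < Fintype.card α := by linarith
  have hkR : (1 : ℝ) ≤ k := by exact_mod_cast hk
  have hmR : (1 : ℝ) ≤ C.maxOut := by exact_mod_cast hm
  have hQR : (1 : ℝ) ≤ C.numStates := by exact_mod_cast hQ
  set A : ℝ := (Fintype.card α : ℝ) with hAdef
  set M : ℝ := (⌈Real.logb A (C.numStates : ℝ)⌉ : ℝ) + Real.logb A (C.maxOut : ℝ) +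
    Real.logb A (k : ℝ) + 1 with hMdef
  have hl : Real.logb A (C.numStates : ℝ) ≤ (⌈Real.logb A (C.numStates : ℝ)⌉ : ℝ) :=
    Int.le_ceil _
  have l1 := Real.logb_nonneg hA1 hQR
  have l2 := Real.logb_nonneg hA1 hmR
  have l3 := Real.logb_nonneg hA1 hkR
  have hM0 : 0 ≤ M := by linarith
  have hM : ∀ w, ((BPDProof.W C k (C.run w) : ℚ) : ℝ) ≤ A ^ M := by
    intro w
    have h1 : ((BPDProof.W C k (C.run w) : ℚ) : ℝ) ≤
        (C.numStates : ℝ) * ((k : ℝ) * C.maxOut + 1) := by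
      exact_mod_cast BPDProof.W_le C hIL w k
    have h2 : A ^ (Real.logb A (C.numStates : ℝ) + Real.logb A (C.maxOut : ℝ) +
        Real.logb A (k : ℝ) + 1) = C.numStates * C.maxOut * k * A := by
      rw [Real.rpow_add hA, Real.rpow_add hA, Real.rpow_add hA, Real.rpow_one,
        Real.rpow_logb hA hA1.ne' (by linarith), Real.rpow_logb hA hA1.ne' (by linarith),
        Real.rpow_logb hA hA1.ne' (by linarith)]
    have h3 : (C.numStates : ℝ) * ((k : ℝ) * C.maxOut + 1) ≤ C.numStates * C.maxOut * k * A := by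
      have hkm : (1 : ℝ) ≤ k * C.maxOut := one_le_mul_of_one_le_of_one_le hkR hmR
      have : (k : ℝ) * C.maxOut + 1 ≤ (k * C.maxOut) * A := by nlinarith
      calc (C.numStates : ℝ) * ((k : ℝ) * C.maxOut + 1)
          ≤ C.numStates * ((k * C.maxOut) * A) := by gcongr
        _ = _ := by ring
    refine h1.trans (h3.trans ?_)
    rw [← h2]
    apply Real.rpow_le_rpow_of_exponent_le hA1.le
    linarith
  refine ⟨BPDProof.gam C k hk (4 * k + 2 * P), fun w => ?_⟩
  have hR : BPDProof.Rep C k P (4 * k + 2 * P) C.q0 [C.z0]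
      (C.q0, BPDProof.mkB (4 * k + 2 * P) [C.z0], ⟨k - 1, by omega⟩) [none] := by
    have hv : (BPDProof.mkB (4 * k + 2 * P) [C.z0]).1 = [C.z0] :=
      BPDProof.mkB_val _ _ (by simp; omega)
    refine ⟨rfl, [], by simp, by simp [hv], by simp, ?_, Or.inr rfl⟩
    rw [hv]; simp; omega
  have hb := BPDProof.main_bound C hc hIL k hk P (4 * k + 2 * P) hP le_rfl M hM0 hM w []
    C.q0 [C.z0] _ _ rfl hR
  have hk1 : k - 1 + 1 = k := by omega
  have hk2 : ((k - 1 : ℕ) : ℝ) = k - 1 := by rw [Nat.cast_sub hk]; simp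
  simp only [hk1, hk2] at hb
  have hW := hM []
  have hW' : ((BPDProof.W C k (some (C.q0, [C.z0])) : ℚ) : ℝ) ≤ A ^ M := hW
  have hWp : (0 : ℝ) < ((BPDProof.W C k (some (C.q0, [C.z0])) : ℚ) : ℝ) := by
    exact_mod_cast BPDProof.W_pos C _ _
  change _ ≤ (BPDProof.gam C k hk (4 * k + 2 * P)).mart w * _ at hb
  have hX0 : 0 ≤ (BPDProof.gam C k hk (4 * k + 2 * P)).mart w := by
    by_contra hneg
    have := mul_neg_of_neg_of_pos (not_le.1 hneg) hWp
    have h0 := (Real.rpow_pos_of_pos hA _).trans_le hb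
    linarith
  have h5 := hb.trans (mul_le_mul_of_nonneg_left hW' hX0)
  rw [← div_le_iff₀ (Real.rpow_pos_of_pos hA _), ← Real.rpow_sub hA] at h5
  refine le_trans (le_of_eq ?_) h5
  congr 1
  have : C.output w = C.outFrom (some (C.q0, [C.z0])) w := rfl
  rw [this, hMdef]
  ring
end

section
/- Let G be a nonvanishing bounded pushdown gambler with at most one λ-transition per input symbol (i.e., 0 < β(q,z)(b) < 1 for all q, z, b). Then for every k ∈ ℤ⁺ there exists an information-lossless bounded pushdown compressor C such that for all w ∈ Σ*: |C(w)| ≤ (1 + 2/k)|w| − log d_G(w), where the logarithm is in base |Σ|. -/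
/-! ### Auxiliary material: blockwise arithmetic coding -/

namespace BlockCode

section Digits

variable {α : Type} [Fintype α]

/-- The digit of a symbol. -/
noncomputable def dig (a : α) : ℕ := (Fintype.equivFin α a : ℕ)

/-- The number in `[0,1)` written by a string in base `|Σ|`. -/
noncomputable def val : List α → ℝ
  | [] => 0
  | a :: l => ((dig a : ℝ) + val l) / (Fintype.card α : ℝ)

lemma dig_lt (a : α) : dig a < Fintype.card α := (Fintype.equivFin α a).2

lemma dig_inj {a b : α} (h : dig a = dig b) : a = b :=
  (Fintype.equivFin α).injective (Fin.ext h)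

lemma val_nonneg (l : List α) : 0 ≤ val l := by
  induction l with
  | nil => simp [val]
  | cons a l ih => simp only [val]; positivity

lemma val_lt_one (l : List α) : val l < 1 := by
  induction l with
  | nil => simp [val]
  | cons a l ih =>
    have h : (dig a : ℝ) + 1 ≤ Fintype.card α := by exact_mod_cast dig_lt a
    have h0 : (0 : ℝ) ≤ dig a := by positivity
    simp only [val]
    rw [div_lt_one (by linarith)]
    linarith

lemma val_append (hα : 2 ≤ Fintype.card α) (l m : List α) :
    val (l ++ m) = val l + val m / (Fintype.card α : ℝ) ^ l.length := by
  have hB : (Fintype.card α : ℝ) ≠ 0 := by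
    have : Fintype.card α ≠ 0 := by omega
    exact_mod_cast this
  induction l with
  | nil => simp [val]
  | cons a l ih =>
    simp only [List.cons_append, val, ih, List.length_cons, pow_succ]
    field_simp
    ring

lemma exists_val (hα : 2 ≤ Fintype.card α) (L : ℕ) : ∀ t : ℝ, 0 ≤ t → t < 1 →
    ∃ l : List α, l.length = L ∧ val l ≤ t ∧ t < val l + 1 / (Fintype.card α : ℝ) ^ L := by
  have hB : (0 : ℝ) < (Fintype.card α : ℝ) := by
    have : 0 < Fintype.card α := by omega
    exact_mod_cast this
  induction L with
  | zero => intro t h0 h1; exact ⟨[], by simp, by simpa [val], by simpa [val]⟩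
  | succ L ih =>
    intro t h0 h1
    have hnn : 0 ≤ (Fintype.card α : ℝ) * t := by positivity
    have h2 := Nat.floor_le hnn
    have h3 := Nat.lt_floor_add_one ((Fintype.card α : ℝ) * t)
    have h4 : ⌊(Fintype.card α : ℝ) * t⌋₊ < Fintype.card α := by
      rw [Nat.floor_lt hnn]; nlinarith
    obtain ⟨l, hl, hl1, hl2⟩ := ih ((Fintype.card α : ℝ) * t - ⌊(Fintype.card α : ℝ) * t⌋₊)
      (by linarith) (by linarith)
    refine ⟨(Fintype.equivFin α).symm ⟨_, h4⟩ :: l, by simp [hl], ?_, ?_⟩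
    · simp only [val, dig, Equiv.apply_symm_apply]
      rw [div_le_iff₀ hB]; linarith
    · simp only [val, dig, Equiv.apply_symm_apply]
      have e : 1 / (Fintype.card α : ℝ) ^ (L + 1)
          = (1 / (Fintype.card α : ℝ) ^ L) / (Fintype.card α : ℝ) := by
        rw [pow_succ]; field_simp
      rw [e, ← add_div, lt_div_iff₀ hB]; linarith

end Digits

section Intervals

variable {α ι : Type} [Fintype α] (bet : ι → α → ℝ)

/-- Cumulative probability of the symbols before `b`. -/
noncomputable def cum (i : ι) (b : α) : ℝ :=
  ∑ a ∈ Finset.univ.filter (fun a : α => dig a < dig b), bet i a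

/-- Left end of the interval of a history. -/
noncomputable def lo : List (α × ι) → ℝ
  | [] => 0
  | x :: h => cum bet x.2 x.1 + bet x.2 x.1 * lo h

/-- Length of the interval of a history. -/
noncomputable def pr : List (α × ι) → ℝ
  | [] => 1
  | x :: h => bet x.2 x.1 * pr h

variable (hpos : ∀ i a, 0 < bet i a) (hsum : ∀ i, ∑ a, bet i a = 1)

lemma cum_nonneg (hpos : ∀ i a, 0 < bet i a)
    (i : ι) (b : α) : 0 ≤ cum bet i b :=
  Finset.sum_nonneg fun a _ => (hpos i a).le

lemma cum_add (i : ι) (b : α) : cum bet i b + bet i b =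
    ∑ a ∈ Finset.univ.filter (fun a : α => dig a ≤ dig b), bet i a := by
  classical
  have : Finset.univ.filter (fun a : α => dig a ≤ dig b) =
      insert b (Finset.univ.filter (fun a : α => dig a < dig b)) := by
    ext a
    simp only [Finset.mem_filter, Finset.mem_univ, true_and, Finset.mem_insert]
    constructor
    · intro h
      rcases h.lt_or_eq with h | h
      · exact Or.inr h
      · exact Or.inl (dig_inj h)
    · rintro (h | h)
      · rw [h]
      · exact h.le
  rw [this, Finset.sum_insert (by simp), cum]
  ring

lemma cum_add_le_cum (hpos : ∀ i a, 0 < bet i a)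
    (i : ι) {b c : α} (h : dig b < dig c) :
    cum bet i b + bet i b ≤ cum bet i c := by
  rw [cum_add]
  apply Finset.sum_le_sum_of_subset_of_nonneg
  · intro a
    simp only [Finset.mem_filter, Finset.mem_univ, true_and]
    omega
  · intro a _ _; exact (hpos i a).le

lemma cum_add_le_one (hpos : ∀ i a, 0 < bet i a)
    (hsum : ∀ i, ∑ a, bet i a = 1) (i : ι) (b : α) : cum bet i b + bet i b ≤ 1 := by
  rw [cum_add, ← hsum i]
  apply Finset.sum_le_sum_of_subset_of_nonneg
  · intro a; simp
  · intro a _ _; exact (hpos i a).le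

lemma pr_pos (hpos : ∀ i a, 0 < bet i a)
    (h : List (α × ι)) : 0 < pr bet h := by
  induction h with
  | nil => simp [pr]
  | cons x h ih => exact mul_pos (hpos _ _) ih

lemma lo_nonneg (hpos : ∀ i a, 0 < bet i a)
    (h : List (α × ι)) : 0 ≤ lo bet h := by
  induction h with
  | nil => simp [lo]
  | cons x h ih => exact add_nonneg (cum_nonneg bet hpos _ _) (mul_nonneg (hpos _ _).le ih)

lemma lo_add_pr (hpos : ∀ i a, 0 < bet i a)
    (hsum : ∀ i, ∑ a, bet i a = 1) (h : List (α × ι)) : lo bet h + pr bet h ≤ 1 := by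
  induction h with
  | nil => simp [lo, pr]
  | cons x h ih =>
    have h1 := cum_add_le_one bet hpos hsum x.2 x.1
    have h2 := hpos x.2 x.1
    simp only [lo, pr]
    nlinarith

lemma pr_le_one (hpos : ∀ i a, 0 < bet i a)
    (hsum : ∀ i, ∑ a, bet i a = 1) (h : List (α × ι)) : pr bet h ≤ 1 := by
  have := lo_add_pr bet hpos hsum h
  have := lo_nonneg bet hpos h
  linarith

lemma pr_snoc (h : List (α × ι)) (x : α × ι) :
    pr bet (h ++ [x]) = pr bet h * bet x.2 x.1 := by
  induction h with
  | nil => simp [pr]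
  | cons y h ih => simp only [List.cons_append, pr, ih]; ring

lemma exists_code (hpos : ∀ i a, 0 < bet i a)
    (hsum : ∀ i, ∑ a, bet i a = 1) (hα : 2 ≤ Fintype.card α) (h : List (α × ι)) : ∃ e : List α, e ≠ [] ∧
    (e.length : ℝ) ≤ 2 - Real.logb (Fintype.card α) (pr bet h) ∧
    lo bet h ≤ val e ∧
    val e + 1 / (Fintype.card α : ℝ) ^ e.length ≤ lo bet h + pr bet h := by
  have hB2 : (2 : ℝ) ≤ (Fintype.card α : ℝ) := by exact_mod_cast hα
  have hB : (1 : ℝ) < (Fintype.card α : ℝ) := by linarith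
  have hp := pr_pos bet hpos h
  have hp1 := pr_le_one bet hpos hsum h
  have hl := lo_nonneg bet hpos h
  have hlp := lo_add_pr bet hpos hsum h
  set B : ℝ := (Fintype.card α : ℝ) with hBdef
  have hlog : 0 ≤ - Real.logb B (pr bet h) := by
    have := Real.logb_nonpos hB hp.le hp1
    linarith
  set L := ⌈- Real.logb B (pr bet h)⌉₊ + 1 with hL
  have hBL : 2 / pr bet h ≤ B ^ L := by
    have h1 : 1 / pr bet h ≤ B ^ ⌈- Real.logb B (pr bet h)⌉₊ := by
      have h2 := Nat.le_ceil (- Real.logb B (pr bet h))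
      have h3 : B ^ (- Real.logb B (pr bet h)) ≤
          B ^ ((⌈- Real.logb B (pr bet h)⌉₊ : ℕ) : ℝ) :=
        Real.rpow_le_rpow_of_exponent_le hB.le h2
      rw [Real.rpow_natCast, Real.rpow_neg (by linarith),
        Real.rpow_logb (by linarith) hB.ne' hp] at h3
      simpa using h3
    rw [hL, pow_succ]
    have h4 : 0 < 1 / pr bet h := by positivity
    have h5 : 2 / pr bet h = 1 / pr bet h * 2 := by ring
    rw [h5]
    exact mul_le_mul h1 hB2 (by norm_num) (by positivity)
  have hBpos : 0 < B ^ L := by positivity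
  have hsmall : 2 * (1 / B ^ L) ≤ pr bet h := by
    rw [div_le_iff₀ hp] at hBL
    rw [mul_one_div, div_le_iff₀ hBpos]
    linarith
  have hinv : 0 < 1 / B ^ L := by positivity
  obtain ⟨e, he, he1, he2⟩ := exists_val hα L (lo bet h + 1 / B ^ L) (by linarith) (by linarith)
  refine ⟨e, ?_, ?_, ?_, ?_⟩
  · rintro rfl
    simp [hL] at he
  · rw [he, hL]
    push_cast
    have := Nat.ceil_lt_add_one hlog
    linarith
  · linarith
  · rw [he]; linarith

/-- The codeword of a history: a string whose cylinder lies in its interval. -/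
noncomputable def code (hα : 2 ≤ Fintype.card α) (h : List (α × ι)) : List α :=
  (exists_code bet hpos hsum hα h).choose

lemma code_spec (hα : 2 ≤ Fintype.card α) (h : List (α × ι)) :
    code bet hpos hsum hα h ≠ [] ∧
    ((code bet hpos hsum hα h).length : ℝ) ≤ 2 - Real.logb (Fintype.card α) (pr bet h) ∧
    lo bet h ≤ val (code bet hpos hsum hα h) ∧
    val (code bet hpos hsum hα h) +
      1 / (Fintype.card α : ℝ) ^ (code bet hpos hsum hα h).length ≤ lo bet h + pr bet h :=
  (exists_code bet hpos hsum hα h).choose_spec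

lemma code_mem (hα : 2 ≤ Fintype.card α) (h : List (α × ι)) (u : List α) :
    lo bet h ≤ val (code bet hpos hsum hα h ++ u) ∧
    val (code bet hpos hsum hα h ++ u) < lo bet h + pr bet h := by
  obtain ⟨-, -, h1, h2⟩ := code_spec bet hpos hsum hα h
  have hB : (0 : ℝ) < (Fintype.card α : ℝ) := by
    have : 0 < Fintype.card α := by omega
    exact_mod_cast this
  rw [val_append hα]
  have h3 := val_nonneg u
  have h4 := val_lt_one u
  have hP : 0 < (Fintype.card α : ℝ) ^ (code bet hpos hsum hα h).length := by positivity
  constructor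
  · have : 0 ≤ val u / (Fintype.card α : ℝ) ^ (code bet hpos hsum hα h).length := by positivity
    linarith
  · have : val u / (Fintype.card α : ℝ) ^ (code bet hpos hsum hα h).length <
        1 / (Fintype.card α : ℝ) ^ (code bet hpos hsum hα h).length :=
      div_lt_div_of_pos_right h4 hP
    linarith

end Intervals

section Machine

variable {α ι S : Type} (next : S → α → S) (idx : S → ι)

/-- The history produced by reading a string. -/
def hist : S → List α → List (α × ι)
  | _, [] => []
  | s, b :: w => (b, idx s) :: hist (next s b) w

/-- Update of the block buffer. -/
def upd (k : ℕ) (h : List (α × ι)) (x : α × ι) : List (α × ι) :=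
  if h.length + 1 < k then h ++ [x] else []

/-- Output at one step, for a block code `E`. -/
def out (k : ℕ) (E : List (α × ι) → List α) (h : List (α × ι)) (x : α × ι) : List α :=
  if h.length + 1 < k then [] else E (h ++ [x])

/-- Output of the block coder. -/
def outM (k : ℕ) (E : List (α × ι) → List α) : S → List (α × ι) → List α → List α
  | _, _, [] => []
  | s, h, b :: w => out k E h (b, idx s) ++ outM k E (next s b) (upd k h (b, idx s)) w

/-- Final buffer of the block coder. -/
def fin (k : ℕ) : S → List (α × ι) → List α → List (α × ι)
  | _, h, [] => h
  | s, h, b :: w => fin k (next s b) (upd k h (b, idx s)) w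

lemma hist_length (s : S) (w : List α) : (hist next idx s w).length = w.length := by
  induction w generalizing s with
  | nil => rfl
  | cons b w ih => simp [hist, ih]

lemma hist_inj (s : S) (w w' : List α) (h : hist next idx s w = hist next idx s w') : w = w' := by
  induction w generalizing s w' with
  | nil => cases w' <;> simp_all [hist]
  | cons b w ih =>
    cases w' with
    | nil => simp [hist] at h
    | cons b' w' =>
      simp only [hist, List.cons.injEq, Prod.mk.injEq, and_true] at h
      obtain ⟨rfl, h⟩ := h
      rw [ih _ _ h]

lemma short (k : ℕ) (E : List (α × ι) → List α) (s : S) (h : List (α × ι)) (w : List α)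
    (hw : h.length + w.length < k) :
    outM next idx k E s h w = [] ∧ fin next idx k s h w = h ++ hist next idx s w := by
  induction w generalizing s h with
  | nil => simp [outM, fin, hist]
  | cons b w ih =>
    simp only [List.length_cons] at hw
    have h1 : h.length + 1 < k := by omega
    obtain ⟨i1, i2⟩ := ih (next s b) (h ++ [(b, idx s)]) (by simp; omega)
    simp only [outM, fin, hist, out, upd, if_pos h1]
    exact ⟨by simpa using i1, by simpa using i2⟩

lemma full (k : ℕ) (E : List (α × ι) → List α) (s : S) (h : List (α × ι)) (x w : List α)
    (hx : h.length + x.length = k) (hne : x ≠ []) :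
    outM next idx k E s h (x ++ w) =
      E (h ++ hist next idx s x) ++ outM next idx k E (x.foldl next s) [] w ∧
    fin next idx k s h (x ++ w) = fin next idx k (x.foldl next s) [] w := by
  induction x generalizing s h with
  | nil => exact absurd rfl hne
  | cons b x ih =>
    simp only [List.length_cons] at hx
    by_cases h1 : h.length + 1 < k
    · have hx' : x ≠ [] := by rintro rfl; simp at hx; omega
      obtain ⟨i1, i2⟩ := ih (next s b) (h ++ [(b, idx s)]) (by simp; omega) hx'
      simp only [List.cons_append, outM, fin, hist, out, upd, if_pos h1, List.foldl_cons]
      exact ⟨by simpa using i1, by simpa using i2⟩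
    · have hx' : x = [] := by
        rw [← List.length_eq_zero_iff]; omega
      subst hx'
      simp [outM, fin, hist, out, upd, h1]

variable [Fintype α] (bet : ι → α → ℝ)
variable (hpos : ∀ i a, 0 < bet i a) (hsum : ∀ i, ∑ a, bet i a = 1)

lemma disjoint_hist (hpos : ∀ i a, 0 < bet i a)
    (hsum : ∀ i, ∑ a, bet i a = 1) (s : S) (x y : List α) (hl : x.length = y.length) (t : ℝ)
    (h1 : lo bet (hist next idx s x) ≤ t)
    (h2 : t < lo bet (hist next idx s x) + pr bet (hist next idx s x))
    (h3 : lo bet (hist next idx s y) ≤ t)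
    (h4 : t < lo bet (hist next idx s y) + pr bet (hist next idx s y)) : x = y := by
  induction x generalizing s y t with
  | nil =>
    symm
    rw [← List.length_eq_zero_iff, ← hl]; rfl
  | cons b x ih =>
    cases y with
    | nil => simp at hl
    | cons c y =>
      simp only [hist, lo, pr] at h1 h2 h3 h4
      have hb := hpos (idx s) b
      have hc := hpos (idx s) c
      by_cases hbc : b = c
      · subst hbc
        congr 1
        refine ih (next s b) y (by simpa using hl) ((t - cum bet (idx s) b) / bet (idx s) b)
          ?_ ?_ ?_ ?_
        · rw [le_div_iff₀ hb]; linarith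
        · rw [div_lt_iff₀ hb]; linarith
        · rw [le_div_iff₀ hb]; linarith
        · rw [div_lt_iff₀ hb]; linarith
      · exfalso
        have a1 := lo_nonneg bet hpos (hist next idx (next s b) x)
        have a2 := lo_add_pr bet hpos hsum (hist next idx (next s b) x)
        have a3 := lo_nonneg bet hpos (hist next idx (next s c) y)
        have a4 := lo_add_pr bet hpos hsum (hist next idx (next s c) y)
        rcases lt_trichotomy (dig b) (dig c) with h | h | h
        · have := cum_add_le_cum bet hpos (idx s) h
          nlinarith
        · exact hbc (dig_inj h)
        · have := cum_add_le_cum bet hpos (idx s) h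
          nlinarith

lemma outM_inj (hα : 2 ≤ Fintype.card α) (k : ℕ) (hk : 0 < k) (n : ℕ) :
    ∀ (s : S) (w w' : List α), w.length ≤ n →
    outM next idx k (code bet hpos hsum hα) s [] w =
      outM next idx k (code bet hpos hsum hα) s [] w' →
    fin next idx k s [] w = fin next idx k s [] w' → w = w' := by
  have split : ∀ w : List α, k ≤ w.length → ∃ x u, w = x ++ u ∧ x.length = k ∧ x ≠ [] := by
    intro w hw
    refine ⟨w.take k, w.drop k, by simp, by simp [hw], ?_⟩
    intro h
    have := congrArg List.length h
    simp at this
    rcases this with h | h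
    · omega
    · subst h; simp at hw; omega
  induction n with
  | zero =>
    intro s w w' hw ho hf
    have hw0 : w = [] := by rw [← List.length_eq_zero_iff]; omega
    subst hw0
    by_cases h' : w'.length < k
    · obtain ⟨i1, i2⟩ := short next idx k (code bet hpos hsum hα) s [] w' (by simpa using h')
      rw [i2] at hf
      exact hist_inj next idx s _ _ (by simpa [fin, hist] using hf)
    · obtain ⟨y, v, rfl, hy, hy0⟩ := split w' (by omega)
      obtain ⟨i1, i2⟩ := full next idx k (code bet hpos hsum hα) s [] y v (by simpa using hy) hy0
      rw [i1] at ho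
      have := (code_spec bet hpos hsum hα ([] ++ hist next idx s y)).1
      simp [outM] at ho
      simp [ho] at this
  | succ n ih =>
    intro s w w' hw ho hf
    by_cases h : w.length < k
    · obtain ⟨j1, j2⟩ := short next idx k (code bet hpos hsum hα) s [] w (by simpa using h)
      by_cases h' : w'.length < k
      · obtain ⟨i1, i2⟩ := short next idx k (code bet hpos hsum hα) s [] w' (by simpa using h')
        rw [i2, j2] at hf
        exact hist_inj next idx s _ _ (by simpa using hf)
      · obtain ⟨y, v, rfl, hy, hy0⟩ := split w' (by omega)
        obtain ⟨i1, i2⟩ := full next idx k (code bet hpos hsum hα) s [] y v (by simpa using hy) hy0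
        rw [i1, j1] at ho
        have := (code_spec bet hpos hsum hα ([] ++ hist next idx s y)).1
        have ho' := ho.symm
        rw [List.append_eq_nil_iff] at ho'
        exact absurd ho'.1 this
    · obtain ⟨x, u, rfl, hx, hx0⟩ := split w (by omega)
      obtain ⟨j1, j2⟩ := full next idx k (code bet hpos hsum hα) s [] x u (by simpa using hx) hx0
      by_cases h' : w'.length < k
      · obtain ⟨i1, i2⟩ := short next idx k (code bet hpos hsum hα) s [] w' (by simpa using h')
        rw [i1, j1] at ho
        have := (code_spec bet hpos hsum hα ([] ++ hist next idx s x)).1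
        rw [List.append_eq_nil_iff] at ho
        exact absurd ho.1 this
      · obtain ⟨y, v, rfl, hy, hy0⟩ := split w' (by omega)
        obtain ⟨i1, i2⟩ := full next idx k (code bet hpos hsum hα) s [] y v (by simpa using hy) hy0
        rw [i1, j1] at ho
        rw [i2, j2] at hf
        simp only [List.nil_append] at ho
        have c1 := code_mem bet hpos hsum hα (hist next idx s x)
          (outM next idx k (code bet hpos hsum hα) (x.foldl next s) [] u)
        have c2 := code_mem bet hpos hsum hα (hist next idx s y)
          (outM next idx k (code bet hpos hsum hα) (y.foldl next s) [] v)
        rw [← ho] at c2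
        have hxy : x = y := disjoint_hist next idx bet hpos hsum s x y (by omega) _
          c1.1 c1.2 c2.1 c2.2
        subst hxy
        rw [List.append_cancel_left_eq] at ho
        simp only [List.length_append] at hw
        rw [ih (x.foldl next s) u v (by omega) ho hf]

lemma outM_length (hα : 2 ≤ Fintype.card α) (k : ℕ) (hk : 0 < k) (w : List α) :
    ∀ (s : S) (h : List (α × ι)), h.length < k →
    ((outM next idx k (code bet hpos hsum hα) s h w).length : ℝ) ≤
      (2 / (k : ℝ)) * (w.length : ℝ) -
        Real.logb (Fintype.card α) (pr bet (hist next idx s w)) +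
      ((2 / (k : ℝ)) * (h.length : ℝ) - Real.logb (Fintype.card α) (pr bet h)) := by
  have hB2 : (2 : ℝ) ≤ (Fintype.card α : ℝ) := by exact_mod_cast hα
  have hB : (1 : ℝ) < (Fintype.card α : ℝ) := by linarith
  have hk0 : (0 : ℝ) < k := by exact_mod_cast hk
  induction w with
  | nil =>
    intro s h hh
    have h1 := Real.logb_nonpos hB (pr_pos bet hpos h).le (pr_le_one bet hpos hsum h)
    have h2 : 0 ≤ (2 / (k : ℝ)) * (h.length : ℝ) := by positivity
    simp only [outM, hist, pr, List.length_nil, Nat.cast_zero, Real.logb_one]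
    linarith
  | cons b w ih =>
    intro s h hh
    have e1 : Real.logb (Fintype.card α) (pr bet (hist next idx s (b :: w))) =
        Real.logb (Fintype.card α) (bet (idx s) b) +
          Real.logb (Fintype.card α) (pr bet (hist next idx (next s b) w)) := by
      simp only [hist, pr]
      exact Real.logb_mul (hpos _ _).ne' (pr_pos bet hpos _).ne'
    have e2 : Real.logb (Fintype.card α) (pr bet (h ++ [(b, idx s)])) =
        Real.logb (Fintype.card α) (pr bet h) +
          Real.logb (Fintype.card α) (bet (idx s) b) := by
      rw [pr_snoc]
      exact Real.logb_mul (pr_pos bet hpos _).ne' (hpos _ _).ne'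
    by_cases h1 : h.length + 1 < k
    · have := ih (next s b) (h ++ [(b, idx s)]) (by simpa using h1)
      simp only [outM, out, upd, if_pos h1, List.nil_append]
      simp only [List.length_append, List.length_cons, List.length_nil] at this ⊢
      rw [e2] at this
      rw [e1]
      push_cast at this ⊢
      linarith
    · have := ih (next s b) [] (by simpa using hk)
      have c1 := (code_spec bet hpos hsum hα (h ++ [(b, idx s)])).2.1
      simp only [outM, out, upd, if_neg h1]
      simp only [pr, List.length_nil, Nat.cast_zero, Real.logb_one] at this
      simp only [List.length_append, List.length_cons]
      rw [e1]
      rw [e2] at c1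
      have hlen : (h.length : ℝ) = k - 1 := by
        have : h.length + 1 = k := by omega
        rw [← this]; push_cast; ring
      have h2 : (2 / (k : ℝ)) * k = 2 := by field_simp
      rw [hlen]
      push_cast
      linarith

end Machine

section Sim

variable {α : Type} [Fintype α] (G : BPDG α)

/-- Bet indices: the (state, top symbol) pair, or `none` for the fair bet. -/
abbrev Idx : Type := Option (G.Q × G.Γ)

/-- The betting distribution of an index. -/
noncomputable def ibet : Idx G → α → ℝ
  | some p, b => (G.β p.1 p.2 b : ℝ)
  | none, _ => 1 / (Fintype.card α : ℝ)

/-- The index of a configuration. -/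
def cidx : Option (G.Q × List G.Γ) → Idx G
  | some (q, a :: _) => some (q, a)
  | _ => none

/-- The (total) transition on possibly undefined configurations. -/
def cnext (o : Option (G.Q × List G.Γ)) (b : α) : Option (G.Q × List G.Γ) :=
  o.bind (symStep G.δ G.c b)

lemma betAt_eq (o : Option (G.Q × List G.Γ)) (b : α) : G.betAt o b = ibet G (cidx G o) b := by
  rcases o with _ | ⟨q, _ | ⟨a, v⟩⟩ <;> rfl

lemma martFrom_eq (o : Option (G.Q × List G.Γ)) (w : List α) :
    G.martFrom o w = (Fintype.card α : ℝ) ^ w.length *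
      pr (ibet G) (hist (cnext G) (cidx G) o w) := by
  induction w generalizing o with
  | nil => simp [BPDG.martFrom, hist, pr]
  | cons b w ih =>
    simp only [BPDG.martFrom, hist, pr, List.length_cons, pow_succ, betAt_eq]
    rw [ih]
    simp only [cnext]
    ring

/-- Buffers of the compressor. -/
abbrev Buf (k : ℕ) : Type := {h : List (α × Idx G) // h.length < k}

/-- States of the compressor: simulated state (`none` if the gambler is stuck),
pending bet recorded before a silent move, and block buffer. -/
abbrev CQ (k : ℕ) : Type := Option G.Q × Idx G × Buf G k

lemma upd_length (k : ℕ) (hk : 0 < k) (h : List (α × Idx G)) (x : α × Idx G) :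
    (upd k h x).length < k := by
  unfold upd
  split_ifs with h1
  · simpa using h1
  · simpa using hk

/-- Buffer update. -/
def bupd (k : ℕ) (hk : 0 < k) (h : Buf G k) (x : α × Idx G) : Buf G k :=
  ⟨upd k h.1 x, upd_length G k hk h.1 x⟩

open Classical in
/-- Transition function of the compressor. -/
noncomputable def cδ (k : ℕ) (hk : 0 < k) :
    CQ G k → Option α → G.Γ → Option (CQ G k × List G.Γ)
  | (some q, pend, h), none, a =>
      (G.δ q none a).map fun p => ((some p.1, some (pend.getD (q, a)), h), p.2)
  | (none, _, _), none, _ => none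
  | (none, pend, h), some b, a => some ((none, none, bupd G k hk h (b, pend)), [a])
  | (some q, pend, h), some b, a =>
      if G.δ q none a = none then
        match G.δ q (some b) a with
        | none => some ((none, none, bupd G k hk h (b, some (pend.getD (q, a)))), [a])
        | some p => some ((some p.1, none, bupd G k hk h (b, some (pend.getD (q, a)))), p.2)
      else none

/-- Output function of the compressor. -/
def cν (k : ℕ) (E : List (α × Idx G) → List α) : CQ G k → α → G.Γ → List α
  | (none, pend, h), b, _ => out k E h.1 (b, pend)
  | (some q, pend, h), b, a => out k E h.1 (b, some (pend.getD (q, a)))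

lemma lamStep_dead (k : ℕ) (hk : 0 < k) (pend : Idx G) (h : Buf G k) (st : List G.Γ) :
    lamStep (cδ G k hk) ((none, pend, h), st) = none := by
  cases st <;> simp [lamStep, cδ]

lemma lamIter_none (k : ℕ) (hk : 0 < k) (n : ℕ) (q : G.Q) (pend : Idx G) (h : Buf G k)
    (st : List G.Γ) (hG : lamIter G.δ n (q, st) = none) :
    lamIter (cδ G k hk) n ((some q, pend, h), st) = none := by
  induction n generalizing q pend st with
  | zero => simp [lamIter] at hG
  | succ n ih =>
    cases st with
    | nil => simp [lamIter, lamStep]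
    | cons a v =>
      simp only [lamIter, lamStep, cδ] at hG ⊢
      cases hd : G.δ q none a with
      | none => simp
      | some p =>
        simp only [hd, Option.map_some, Option.bind_some] at hG ⊢
        exact ih _ _ _ hG

/-- The compressor. -/
noncomputable def comp (k : ℕ) (hk : 0 < k) (E : List (α × Idx G) → List α) : BPDC α where
  Q := CQ G k
  Γ := G.Γ
  fintypeQ := by
    letI := G.fintypeQ
    letI := G.fintypeΓ
    haveI : Finite (Buf G k) := (List.finite_length_lt (α × Idx G) k).to_subtype
    exact Fintype.ofFinite _
  fintypeΓ := G.fintypeΓ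
  δ := cδ G k hk
  ν := cν G k E
  q0 := (some G.q0, none, ⟨[], hk⟩)
  z0 := G.z0
  c := G.c
  det := by
    rintro ⟨_ | q, pend, h⟩ a
    · left; rfl
    · by_cases hd : G.δ q none a = none
      · left; simp [cδ, hd]
      · right; intro b; simp [cδ, hd]
  bottom := by
    rintro ⟨_ | q, pend, h⟩ (_ | b)
    · left; rfl
    · right; exact ⟨_, [], rfl⟩
    · rcases G.bottom q none with h1 | ⟨q', v, h1⟩
      · left; simp [cδ, h1]
      · right; exact ⟨(some q', some (pend.getD (q, G.z0)), h), v, by simp [cδ, h1]⟩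
    · by_cases hd : G.δ q none G.z0 = none
      · right
        rcases G.bottom q (some b) with h1 | ⟨q', v, h1⟩
        · exact ⟨_, [], by simp [cδ, hd, h1]; rfl⟩
        · exact ⟨_, v, by simp [cδ, hd, h1]; rfl⟩
      · left; simp [cδ, hd]
  lamBound := by
    rintro ⟨⟨_ | q, pend, h⟩, st⟩
    · simp [lamIter, lamStep_dead]
    · exact lamIter_none G k hk _ q pend h st (G.lamBound _)

/-- Simulation relation. -/
inductive Rel (k : ℕ) : Option (G.Q × List G.Γ) → Buf G k → CQ G k × List G.Γ → Prop
  | live (q : G.Q) (h : Buf G k) (v : List G.Γ) :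
      Rel k (some (q, v ++ [G.z0])) h ((some q, none, h), v ++ [G.z0])
  | dead (h : Buf G k) (a : G.Γ) (v : List G.Γ) : Rel k none h ((none, none, h), a :: v)

lemma bottom_keep (q q' : G.Q) (b : Option α) (a : G.Γ) (u r st : List G.Γ)
    (hst : st ++ [G.z0] = a :: r) (hd : G.δ q b a = some (q', u)) :
    ∃ v', u ++ r = v' ++ [G.z0] := by
  cases st with
  | nil =>
    simp only [List.nil_append, List.cons.injEq] at hst
    obtain ⟨rfl, rfl⟩ := hst
    rcases G.bottom q b with h | ⟨q1, v, h⟩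
    · simp [hd] at h
    · rw [hd] at h
      simp only [Option.some.injEq, Prod.mk.injEq] at h
      exact ⟨v, by simp [h.2]⟩
  | cons c st =>
    simp only [List.cons_append, List.cons.injEq] at hst
    obtain ⟨rfl, rfl⟩ := hst
    exact ⟨u ++ st, by simp⟩

/-- One reading move, once no silent move is available. -/
lemma read_sim (k : ℕ) (hk : 0 < k) (q : G.Q) (pend : Idx G) (h : Buf G k) (b : α)
    (a : G.Γ) (r st : List G.Γ) (hst : st ++ [G.z0] = a :: r) (hn : G.δ q none a = none) :
    ∃ cfg', ((cδ G k hk (some q, pend, h) (some b) a).map fun p => (p.1, p.2 ++ r)) = some cfg' ∧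
      Rel G k ((G.δ q (some b) a).map fun p => (p.1, p.2 ++ r))
        (bupd G k hk h (b, some (pend.getD (q, a)))) cfg' := by
  cases hd : G.δ q (some b) a with
  | none =>
    refine ⟨_, by simp [cδ, hn, hd]; rfl, ?_⟩
    exact Rel.dead _ a r
  | some p =>
    obtain ⟨q', u⟩ := p
    obtain ⟨v', hv'⟩ := bottom_keep G q q' (some b) a u r st hst hd
    refine ⟨_, by simp [cδ, hn, hd]; rfl, ?_⟩
    simp only [Option.map_some, hv']
    exact Rel.live q' _ v'

lemma step_sim (hc : G.c = 1) (k : ℕ) (hk : 0 < k) (E : List (α × Idx G) → List α)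
    (o : Option (G.Q × List G.Γ)) (h : Buf G k) (cfg : CQ G k × List G.Γ)
    (hR : Rel G k o h cfg) (b : α) :
    (comp G k hk E).outAt (some cfg) b = out k E h.1 (b, cidx G o) ∧
    ∃ cfg', symStep (cδ G k hk) G.c b cfg = some cfg' ∧
      Rel G k (cnext G o b) (bupd G k hk h (b, cidx G o)) cfg' := by
  cases hR with
  | dead h a v =>
    refine ⟨rfl, ((none, none, bupd G k hk h (b, none)), a :: v), ?_, ?_⟩
    · rw [hc]
      simp [symStep, lamStar, lamStep_dead, cδ]
    · exact Rel.dead _ a v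
  | live q h v =>
    obtain ⟨a, r, hv⟩ : ∃ a r, v ++ [G.z0] = a :: r := by
      cases v with
      | nil => exact ⟨_, _, rfl⟩
      | cons a v => exact ⟨_, _, rfl⟩
    have hlb := G.lamBound (q, a :: r)
    rw [hc] at hlb
    rw [hv]
    refine ⟨rfl, ?_⟩
    simp only [cnext, Option.bind_some, hc, cidx]
    cases hd : G.δ q none a with
    | none =>
      have e1 : symStep (cδ G k hk) 1 b ((some q, none, h), a :: r) =
          (cδ G k hk (some q, none, h) (some b) a).map fun p => (p.1, p.2 ++ r) := by
        have : lamStar (cδ G k hk) 1 ((some q, none, h), a :: r) =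
            ((some q, none, h), a :: r) := by simp [lamStar, lamStep, cδ, hd]
        simp only [symStep, this]
      have e2 : symStep G.δ 1 b (q, a :: r) =
          (G.δ q (some b) a).map fun p => (p.1, p.2 ++ r) := by
        have : lamStar G.δ 1 (q, a :: r) = (q, a :: r) := by simp [lamStar, lamStep, hd]
        simp only [symStep, this]
      rw [e1, e2]
      exact read_sim G k hk q none h b a r v hv hd
    | some p =>
      obtain ⟨q1, u⟩ := p
      obtain ⟨v1, hv1⟩ := bottom_keep G q q1 none a u r v hv hd
      obtain ⟨a1, r1, hv2⟩ : ∃ a1 r1, v1 ++ [G.z0] = a1 :: r1 := by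
        cases v1 with
        | nil => exact ⟨_, _, rfl⟩
        | cons a v => exact ⟨_, _, rfl⟩
      have hn : G.δ q1 none a1 = none := by
        simp only [lamIter, lamStep, hd, Option.map_some, Option.bind_some, hv1, hv2] at hlb
        cases hx : G.δ q1 none a1 with
        | none => rfl
        | some p => simp [hx] at hlb
      have e1 : symStep (cδ G k hk) 1 b ((some q, none, h), a :: r) =
          (cδ G k hk (some q1, some (q, a), h) (some b) a1).map fun p => (p.1, p.2 ++ r1) := by
        have : lamStar (cδ G k hk) 1 ((some q, none, h), a :: r) =
            ((some q1, some (q, a), h), a1 :: r1) := by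
          simp [lamStar, lamStep, cδ, hd, hv1, hv2]
        simp only [symStep, this]
      have e2 : symStep G.δ 1 b (q, a :: r) =
          (G.δ q1 (some b) a1).map fun p => (p.1, p.2 ++ r1) := by
        have : lamStar G.δ 1 (q, a :: r) = (q1, a1 :: r1) := by
          simp [lamStar, lamStep, hd, hv1, hv2]
        simp only [symStep, this]
      rw [e1, e2]
      exact read_sim G k hk q1 (some (q, a)) h b a1 r1 v1 hv2 hn

lemma run_sim (hc : G.c = 1) (k : ℕ) (hk : 0 < k) (E : List (α × Idx G) → List α)
    (w : List α) : ∀ (o : Option (G.Q × List G.Γ)) (h : Buf G k) (cfg : CQ G k × List G.Γ),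
    Rel G k o h cfg →
    (comp G k hk E).outFrom (some cfg) w = outM (cnext G) (cidx G) k E o h.1 w ∧
    ∃ (cfg' : CQ G k × List G.Γ), runFrom (cδ G k hk) G.c cfg w = some cfg' ∧
      cfg'.1.2.2.1 = fin (cnext G) (cidx G) k o h.1 w := by
  induction w with
  | nil =>
    intro o h cfg hR
    refine ⟨rfl, cfg, rfl, ?_⟩
    cases hR <;> rfl
  | cons b w ih =>
    intro o h cfg hR
    obtain ⟨h1, cfg', h2, h3⟩ := step_sim G hc k hk E o h cfg hR b
    obtain ⟨i1, cfg'', i2, i3⟩ := ih _ _ _ h3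
    refine ⟨?_, cfg'', ?_, ?_⟩
    · simp only [BPDC.outFrom, outM, h1]
      congr 1
      have : (some cfg : Option (CQ G k × List G.Γ)).bind
          (symStep (comp G k hk E).δ (comp G k hk E).c b) = some cfg' := h2
      exact (congrArg (fun o => (comp G k hk E).outFrom o w) this).trans i1
    · rw [← i2]
      simp only [runFrom, List.foldl_cons, Option.bind_some, h2]
    · simpa only [fin, bupd] using i3

end Sim

end BlockCode

/-- Let `G` be a nonvanishing bounded pushdown gambler with at
most one `λ`-transition per input symbol. Then for every `k ∈ ℤ⁺` there is an
information-lossless bounded pushdown compressor `C` such that for all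
`w ∈ Σ*`, `|C(w)| ≤ (1 + 2/k)|w| - log d_G(w)` (log in base `|Σ|`). -/
theorem bpdc_from_bpdg {α : Type} [Fintype α] (hα : 2 ≤ Fintype.card α)
    (G : BPDG α) (hc : G.c = 1) (hnv : G.nonvanishing) (k : ℕ) (hk : 0 < k) :
    ∃ C : BPDC α, C.IL ∧
      ∀ w : List α,
        ((C.output w).length : ℝ) ≤
          (1 + 2 / (k : ℝ)) * (w.length : ℝ) -
            Real.logb (Fintype.card α) (G.mart w) := by
  classical
  have hB2 : (2 : ℝ) ≤ (Fintype.card α : ℝ) := by exact_mod_cast hα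
  have hB0 : (0 : ℝ) < (Fintype.card α : ℝ) := by linarith
  have hpos : ∀ i a, 0 < BlockCode.ibet G i a := by
    rintro (_ | p) a
    · simp only [BlockCode.ibet]; positivity
    · simp only [BlockCode.ibet]; exact_mod_cast (hnv p.1 p.2 a).1
  have hsum : ∀ i, ∑ a, BlockCode.ibet G i a = 1 := by
    rintro (_ | p)
    · simp only [BlockCode.ibet, Finset.sum_const, Finset.card_univ, nsmul_eq_mul]
      field_simp
    · simp only [BlockCode.ibet]; exact_mod_cast G.β_sum p.1 p.2
  have hR : BlockCode.Rel G k (some (G.q0, [G.z0])) ⟨[], hk⟩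
      ((some G.q0, none, ⟨[], hk⟩), [G.z0]) := BlockCode.Rel.live G.q0 ⟨[], hk⟩ []
  have sim := fun w => BlockCode.run_sim G hc k hk
    (BlockCode.code (BlockCode.ibet G) hpos hsum hα) w _ _ _ hR
  refine ⟨BlockCode.comp G k hk (BlockCode.code (BlockCode.ibet G) hpos hsum hα), ?_, ?_⟩
  · intro w w' h
    obtain ⟨o1, c1, r1, f1⟩ := sim w
    obtain ⟨o2, c2, r2, f2⟩ := sim w'
    have ho := congrArg Prod.fst h
    have hr := congrArg Prod.snd h
    have hr' : (some c1 : Option (BlockCode.CQ G k × List G.Γ)).map Prod.fst =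
        (some c2).map Prod.fst := by
      rw [← r1, ← r2]; exact hr
    simp only [Option.map_some, Option.some.injEq] at hr'
    refine BlockCode.outM_inj (BlockCode.cnext G) (BlockCode.cidx G) (BlockCode.ibet G)
      hpos hsum hα k hk w.length (some (G.q0, [G.z0])) w w' le_rfl ?_ ?_
    · exact o1.symm.trans (Eq.trans ho o2)
    · rw [← f1, ← f2, hr']
  · intro w
    obtain ⟨o1, -⟩ := sim w
    have hl := BlockCode.outM_length (BlockCode.cnext G) (BlockCode.cidx G) (BlockCode.ibet G)
      hpos hsum hα k hk w (some (G.q0, [G.z0])) [] hk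
    have e : Real.logb (Fintype.card α) (G.mart w) = w.length +
        Real.logb (Fintype.card α) (BlockCode.pr (BlockCode.ibet G)
          (BlockCode.hist (BlockCode.cnext G) (BlockCode.cidx G) (some (G.q0, [G.z0])) w)) := by
      rw [BPDG.mart, BlockCode.martFrom_eq,
        Real.logb_mul (by positivity) (BlockCode.pr_pos _ hpos _).ne', Real.logb_pow,
        Real.logb_self_eq_one (by linarith), mul_one]
    have o2 : (BlockCode.comp G k hk
        (BlockCode.code (BlockCode.ibet G) hpos hsum hα)).output w = _ := o1
    rw [o2, e]
    simp only [BlockCode.pr, List.length_nil, Nat.cast_zero, Real.logb_one] at hl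
    linarith
end
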